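/- Let γ > 0, α > −1, and 1 < q < ∞. There exists a constant C > 0, depending only on γ, q, α, n, such that (∫_{D(z,γ)} |1−⟨w,u⟩|^{−q(n+1+α)} dτ(w))^{1/q} ≤ C / ϱ(z,u)^{n+1+α} for all z, u ∈ 𝔹_n with z ≠ u. -/

import Mathlib

open MeasureTheory Filter Topology
open scoped Classical ENNReal

noncomputable section

/-- `ℂⁿ` with the Euclidean norm. -/
abbrev En (n : ℕ) := EuclideanSpace ℂ (Fin n)

instance (n : ℕ) : MeasurableSpace (En n) := borel _
instance (n : ℕ) : BorelSpace (En n) := ⟨rfl⟩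

/-- The Lebesgue volume measure on `ℂⁿ`. -/
def vol (n : ℕ) : Measure (En n) := Measure.addHaar

/-- The open unit ball `𝔹ₙ` of `ℂⁿ`. -/
def uball (n : ℕ) : Set (En n) := Metric.ball 0 1

/-- The Hermitian pairing `⟨z,w⟩ = ∑ⱼ zⱼ * conj wⱼ`. -/
def herm {n : ℕ} (z w : En n) : ℂ := ∑ j, z j * (starRingEnd ℂ) (w j)

/-- The orthogonal projection `P_z w` onto the line spanned by `z`. -/
def prj {n : ℕ} (z w : En n) : En n :=
  if z = 0 then 0 else (herm w z / herm z z) • z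

/-- The Möbius automorphism `φ_z` of the unit ball. -/
def mobius {n : ℕ} (z w : En n) : En n :=
  ((1 : ℂ) / (1 - herm w z)) •
    (z - prj z w - ((Real.sqrt (1 - ‖z‖ ^ 2) : ℝ) : ℂ) • (w - prj z w))

/-- The Bergman metric `β(z,w)`. -/
def bmet {n : ℕ} (z w : En n) : ℝ :=
  (1 / 2) * Real.log ((1 + ‖mobius z w‖) / (1 - ‖mobius z w‖))

/-- The Bergman metric ball `D(z,γ)`. -/
def Dball {n : ℕ} (z : En n) (γ : ℝ) : Set (En n) :=
  {w | w ∈ uball n ∧ bmet z w < γ}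

/-- The normalizing constant `c_α`. -/
def cnorm (n : ℕ) (α : ℝ) : ℝ :=
  if -1 < α then Real.Gamma (n + α + 1) / (n.factorial * Real.Gamma (α + 1)) else 1

/-- The weighted measure `dv_α = c_α (1-|z|²)^α dv` on the unit ball. -/
def measA (n : ℕ) (α : ℝ) : Measure (En n) :=
  ((vol n).restrict (uball n)).withDensity
    (fun z => ENNReal.ofReal (cnorm n α * (1 - ‖z‖ ^ 2) ^ α))

/-- The invariant measure `dτ = (1-|z|²)^{-(n+1)} dv` on the unit ball. -/
def measTau (n : ℕ) : Measure (En n) :=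
  ((vol n).restrict (uball n)).withDensity
    (fun z => ENNReal.ofReal ((1 - ‖z‖ ^ 2) ^ (-((n : ℝ) + 1))))

/-- The Bergman space (quasi-)norm `‖f‖_{p,α}`, valued in `ℝ≥0∞`. -/
def apnorm (n : ℕ) (p α : ℝ) (f : En n → ℂ) : ℝ≥0∞ :=
  (∫⁻ z, ENNReal.ofReal (‖f z‖ ^ p) ∂measA n α) ^ (1 / p)

/-- The radial derivative `Rf(z) = ∑ z_k ∂f/∂z_k = Df(z)[z]`. -/
def radD {n : ℕ} (f : En n → ℂ) (z : En n) : ℂ := fderiv ℂ f z z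

/-- Iterated radial derivative `R^k f`. -/
def radIter {n : ℕ} : ℕ → (En n → ℂ) → En n → ℂ
  | 0, f => f
  | (k + 1), f => radD (radIter k f)

/-- The pseudo-metric `ϱ` on the unit ball. -/
def rho {n : ℕ} (z w : En n) : ℝ :=
  if z ≠ 0 ∧ w ≠ 0 then
    |‖z‖ - ‖w‖| + ‖1 - herm z w / ((‖z‖ : ℂ) * (‖w‖ : ℂ))‖
  else ‖z‖ + ‖w‖


lemma herm_eq {n : ℕ} (z w : En n) : herm z w = inner ℂ w z := by
  simp [herm, PiLp.inner_apply]

lemma herm_norm_le {n : ℕ} (z w : En n) : ‖herm z w‖ ≤ ‖z‖ * ‖w‖ := by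
  rw [herm_eq, mul_comm]; exact norm_inner_le_norm _ _

lemma herm_self {n : ℕ} (z : En n) : herm z z = ((‖z‖ ^ 2 : ℝ) : ℂ) := by
  rw [herm_eq, inner_self_eq_norm_sq_to_K]; norm_num

lemma mob_num {n : ℕ} (z w : En n) (hz : ‖z‖ < 1) :
    ‖z - prj z w - ((Real.sqrt (1 - ‖z‖ ^ 2) : ℝ) : ℂ) • (w - prj z w)‖ ^ 2
      = ‖1 - herm w z‖ ^ 2 - (1 - ‖z‖ ^ 2) * (1 - ‖w‖ ^ 2) := by
  by_cases h0 : z = 0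
  · subst h0
    simp [prj, herm_eq]
  have hs : 0 ≤ 1 - ‖z‖ ^ 2 := by nlinarith [norm_nonneg z]
  have hz0 : (‖z‖ : ℂ) ≠ 0 := by simpa using h0
  obtain ⟨l, hl⟩ : ∃ l : ℂ, l = herm w z / herm z z := ⟨_, rfl⟩
  have hh : herm w z = l * ((‖z‖ ^ 2 : ℝ) : ℂ) := by
    rw [hl, herm_self]; push_cast; field_simp
  have hp : prj z w = l • z := by simp [prj, h0, hl]
  rw [hp]
  obtain ⟨Q, hQ⟩ : ∃ Q, Q = w - l • z := ⟨_, rfl⟩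
  have hw : w = l • z + Q := by rw [hQ]; abel
  have horth : inner ℂ z Q = 0 := by
    rw [hQ, inner_sub_right, inner_smul_right, ← herm_eq, ← herm_eq, hh, herm_self]; ring
  have e1 : ‖w‖ ^ 2 = ‖l‖ ^ 2 * ‖z‖ ^ 2 + ‖Q‖ ^ 2 := by
    rw [hw, @norm_add_sq ℂ, inner_smul_left, horth, norm_smul]; simp; ring
  have e2 : z - l • z = (1 - l) • z := by rw [sub_smul, one_smul]
  rw [← hQ, e2, @norm_sub_sq ℂ, inner_smul_left, inner_smul_right, horth, norm_smul, norm_smul, e1, hh]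
  rw [Complex.norm_real, Real.norm_eq_abs, mul_pow, mul_pow, sq_abs, Real.sq_sqrt hs]
  simp only [mul_zero, map_zero, ← Complex.normSq_eq_norm_sq, Complex.normSq_apply]
  simp only [Complex.sub_re, Complex.sub_im, Complex.one_re, Complex.one_im, Complex.re_mul_ofReal, Complex.im_mul_ofReal]
  ring

lemma one_sub_herm_ge {n : ℕ} (z w : En n) : 1 - ‖z‖ * ‖w‖ ≤ ‖1 - herm z w‖ := by
  have h1 := norm_sub_norm_le (1 : ℂ) (herm z w)
  have h2 := herm_norm_le z w
  rw [norm_one] at h1; linarith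

lemma herm_symm_norm {n : ℕ} (z w : En n) : ‖1 - herm z w‖ = ‖1 - herm w z‖ := by
  rw [← Complex.norm_conj (1 - herm z w), map_sub, map_one, herm_eq, herm_eq, inner_conj_symm]

lemma norm_sub_sq_le {n : ℕ} (z w : En n) (hz : ‖z‖ < 1) (hw : ‖w‖ < 1) :
    ‖z - w‖ ^ 2 ≤ 2 * ‖1 - herm z w‖ := by
  rw [@norm_sub_sq ℂ, herm_symm_norm, herm_eq]
  have h := Complex.re_le_norm (1 - inner ℂ z w)
  simp only [Complex.sub_re, Complex.one_re] at h
  simp only [RCLike.re_to_complex]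
  nlinarith [norm_nonneg z, norm_nonneg w]

lemma D_core {n : ℕ} {γ : ℝ} (hγ : 0 < γ) : ∃ δ : ℝ, 0 < δ ∧ ∀ z w : En n, ‖z‖ < 1 →
    w ∈ Dball z γ → δ * ‖1 - herm w z‖ ^ 2 ≤ (1 - ‖z‖ ^ 2) * (1 - ‖w‖ ^ 2) := by
  refine ⟨Real.exp (-(2 * γ)), Real.exp_pos _, fun z w hz hw => ?_⟩
  obtain ⟨hw1, hw2⟩ := hw
  have hw1 : ‖w‖ < 1 := by simpa [uball] using hw1
  have hnum := mob_num z w hz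
  obtain ⟨r, hr⟩ : ∃ r, r = ‖mobius z w‖ := ⟨_, rfl⟩
  have hpos : 0 < ‖1 - herm w z‖ := by
    have := one_sub_herm_ge w z
    nlinarith [norm_nonneg z, norm_nonneg w]
  have hr2 : r ^ 2 * ‖1 - herm w z‖ ^ 2
      = ‖1 - herm w z‖ ^ 2 - (1 - ‖z‖ ^ 2) * (1 - ‖w‖ ^ 2) := by
    rw [← hnum, hr, mobius, norm_smul, norm_div, norm_one]; field_simp
  have hr0 : 0 ≤ r := hr ▸ norm_nonneg _
  have hpp : 0 < (1 - ‖z‖ ^ 2) * (1 - ‖w‖ ^ 2) := by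
    apply mul_pos <;> nlinarith [norm_nonneg z, norm_nonneg w]
  have hr1 : r < 1 := by
    by_contra hc
    push Not at hc
    nlinarith [sq_nonneg ‖1 - herm w z‖, mul_nonneg (by nlinarith : 0 ≤ r ^ 2 - 1) (sq_nonneg ‖1 - herm w z‖)]
  rw [bmet, ← hr] at hw2
  have h3 : Real.log ((1 + r) / (1 - r)) < 2 * γ := by linarith
  have h4 : (1 + r) / (1 - r) < Real.exp (2 * γ) := by
    rwa [Real.log_lt_iff_lt_exp (div_pos (by linarith) (by linarith))] at h3
  rw [div_lt_iff₀ (by linarith)] at h4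
  have h5 : Real.exp (-(2 * γ)) ≤ 1 - r := by
    rw [Real.exp_neg, inv_le_iff_one_le_mul₀ (Real.exp_pos _)]; nlinarith
  have h6 : Real.exp (-(2 * γ)) ≤ 1 - r ^ 2 := by nlinarith
  nlinarith [mul_le_mul_of_nonneg_right h6 (sq_nonneg ‖1 - herm w z‖)]

lemma D_est {n : ℕ} {δ : ℝ} (hδ : 0 < δ) (z w : En n) (hz : ‖z‖ < 1) (hw : ‖w‖ < 1)
    (h : δ * ‖1 - herm w z‖ ^ 2 ≤ (1 - ‖z‖ ^ 2) * (1 - ‖w‖ ^ 2)) :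
    δ * ‖1 - herm w z‖ ≤ 2 * (1 - ‖z‖ ^ 2) ∧ δ * ‖1 - herm w z‖ ≤ 2 * (1 - ‖w‖ ^ 2) ∧
    δ * (1 - ‖z‖ ^ 2) ≤ 4 * (1 - ‖w‖ ^ 2) := by
  have h1 := one_sub_herm_ge w z
  have hz0 := norm_nonneg z
  have hw0 := norm_nonneg w
  have a1 : 1 - ‖z‖ ^ 2 ≤ 2 * ‖1 - herm w z‖ := by nlinarith
  have a2 : 1 - ‖w‖ ^ 2 ≤ 2 * ‖1 - herm w z‖ := by nlinarith
  have hpos : 0 < ‖1 - herm w z‖ := by nlinarith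
  have b1 : 0 < 1 - ‖z‖ ^ 2 := by nlinarith
  have b2 : 0 < 1 - ‖w‖ ^ 2 := by nlinarith
  have c1 : δ * ‖1 - herm w z‖ ≤ 2 * (1 - ‖z‖ ^ 2) := by
    apply le_of_mul_le_mul_right _ hpos; nlinarith
  have c2 : δ * ‖1 - herm w z‖ ≤ 2 * (1 - ‖w‖ ^ 2) := by
    apply le_of_mul_le_mul_right _ hpos; nlinarith
  exact ⟨c1, c2, by nlinarith⟩

lemma quasi_tri {n : ℕ} (z w u : En n) (hz : ‖z‖ < 1) (hw : ‖w‖ < 1) (hu : ‖u‖ < 1) :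
    ‖1 - herm z u‖ ≤ 2 * ‖1 - herm z w‖ + 4 * ‖1 - herm w u‖ := by
  have e : 1 - herm z u = (1 - herm z w) + (1 - herm w u) - ((1 - ‖w‖ ^ 2 : ℝ) : ℂ)
      - herm (z - w) (u - w) := by
    have := herm_self w
    simp only [herm_eq] at *
    rw [inner_sub_left, inner_sub_right, inner_sub_right, this]; push_cast; ring
  have h1 : ‖herm (z - w) (u - w)‖ ≤ ‖1 - herm z w‖ + ‖1 - herm w u‖ := by
    have k1 := norm_sub_sq_le z w hz hw
    have k2 := norm_sub_sq_le u w hu hw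
    rw [herm_symm_norm] at k2
    have := herm_norm_le (z - w) (u - w)
    nlinarith [sq_nonneg (‖z - w‖ - ‖u - w‖)]
  have hB := one_sub_herm_ge w u
  have h2 : ‖((1 - ‖w‖ ^ 2 : ℝ) : ℂ)‖ ≤ 2 * ‖1 - herm w u‖ := by
    rw [Complex.norm_real, Real.norm_eq_abs, abs_of_nonneg] <;>
    nlinarith [norm_nonneg w, norm_nonneg u]
  rw [e]
  have t1 := norm_sub_le ((1 - herm z w) + (1 - herm w u) - ((1 - ‖w‖ ^ 2 : ℝ) : ℂ)) (herm (z - w) (u - w))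
  have t2 := norm_sub_le ((1 - herm z w) + (1 - herm w u)) (((1 - ‖w‖ ^ 2 : ℝ) : ℂ))
  have t3 := norm_add_le (1 - herm z w) (1 - herm w u)
  linarith

lemma rho_le {n : ℕ} (z u : En n) (hz : ‖z‖ < 1) (hu : ‖u‖ < 1) :
    rho z u ≤ 5 * ‖1 - herm z u‖ := by
  have hB := one_sub_herm_ge z u
  have hz0 := norm_nonneg z
  have hu0 := norm_nonneg u
  unfold rho
  split_ifs with h
  · have h1 : |‖z‖ - ‖u‖| ≤ ‖1 - herm z u‖ := by
      rw [abs_le]; constructor <;> nlinarith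
    have ht : 0 < ‖z‖ * ‖u‖ := mul_pos (norm_pos_iff.2 h.1) (norm_pos_iff.2 h.2)
    have ht1 : ‖z‖ * ‖u‖ < 1 := by nlinarith
    have hc := herm_norm_le z u
    obtain ⟨t, htt⟩ : ∃ t : ℝ, t = ‖z‖ * ‖u‖ := ⟨_, rfl⟩
    have htc : (‖z‖ : ℂ) * (‖u‖ : ℂ) = (t : ℂ) := by rw [htt]; push_cast; ring
    rw [htc]
    rw [← htt] at ht ht1 hc hB
    have ht0 : (t : ℂ) ≠ 0 := by exact_mod_cast ht.ne'
    have e : ‖1 - herm z u / (t : ℂ)‖ * t = ‖(t : ℂ) - herm z u‖ := by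
      have : (t : ℂ) - herm z u = (1 - herm z u / (t : ℂ)) * t := by field_simp
      rw [this, norm_mul, Complex.norm_real, Real.norm_eq_abs, abs_of_pos ht]
    have e2 : ‖(t : ℂ) - herm z u‖ ≤ t + t := by
      refine (norm_sub_le _ _).trans ?_
      rw [Complex.norm_real, Real.norm_eq_abs, abs_of_pos ht]; linarith
    have e3 : ‖(t : ℂ) - herm z u‖ ≤ ‖1 - herm z u‖ + (1 - t) := by
      have : (t : ℂ) - herm z u = (1 - herm z u) - ((1 - t : ℝ) : ℂ) := by push_cast; ring
      rw [this]
      refine (norm_sub_le _ _).trans ?_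
      rw [Complex.norm_real, Real.norm_eq_abs, abs_of_pos (by linarith : 0 < 1 - t)]
    have h2 : ‖1 - herm z u / (t : ℂ)‖ ≤ 4 * ‖1 - herm z u‖ := by
      apply le_of_mul_le_mul_right _ ht
      rw [e]
      by_cases hh : 1 / 2 ≤ t <;> nlinarith
    linarith
  · have : herm z u = 0 := by
      rw [herm_eq]
      by_cases h0 : z = 0
      · simp [h0]
      · have : u = 0 := by tauto
        simp [this]
    rw [this]; simp; linarith

lemma rho_pos {n : ℕ} (z u : En n) (h : z ≠ u) : 0 < rho z u := by
  unfold rho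
  split_ifs with h0
  · by_contra hc
    have a1 := abs_nonneg (‖z‖ - ‖u‖)
    have a2 := norm_nonneg (1 - herm z u / ((‖z‖ : ℂ) * (‖u‖ : ℂ)))
    have b1 : |‖z‖ - ‖u‖| = 0 := by linarith
    have b2 : ‖1 - herm z u / ((‖z‖ : ℂ) * (‖u‖ : ℂ))‖ = 0 := by linarith
    rw [abs_eq_zero, sub_eq_zero] at b1
    rw [norm_eq_zero, sub_eq_zero] at b2
    have hz : (‖u‖ : ℂ) ≠ 0 := by simpa using h0.2
    rw [b1] at b2
    have b3 : herm z u = ‖u‖ * ‖u‖ := by field_simp at b2; rw [← b2]; ring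
    apply h
    have : ‖z - u‖ ^ 2 = 0 := by
      rw [@norm_sub_sq ℂ, ← inner_conj_symm, ← herm_eq, b3, b1]
      simp; ring
    have := pow_eq_zero_iff (two_ne_zero) |>.1 this
    exact sub_eq_zero.1 (norm_eq_zero.1 this)
  · have : 0 < ‖z‖ ∨ 0 < ‖u‖ := by
      by_contra hc
      push Not at hc
      exact h ((norm_le_zero_iff.1 hc.1).trans (norm_le_zero_iff.1 hc.2).symm)
    rcases this with h1 | h1
    · linarith [norm_nonneg u]
    · linarith [norm_nonneg z]


lemma vol_lin {n : ℕ} (z : En n) (hz : ‖z‖ < 1) (R : ℝ) (S : Set (En n))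
    (hS : ∀ w ∈ S, ‖(((Real.sqrt (1 - ‖z‖ ^ 2))⁻¹ : ℝ) : ℂ) • ((w - z) +
      ((((Real.sqrt (1 - ‖z‖ ^ 2))⁻¹ - 1) / ‖z‖ ^ 2 : ℝ) : ℂ) • (herm (w - z) z) • z)‖ < R) :
    vol n S ≤ ENNReal.ofReal ((1 - ‖z‖ ^ 2) ^ (n + 1)) * vol n (Metric.ball 0 R) := by
  have hs : 0 < 1 - ‖z‖ ^ 2 := by nlinarith [norm_nonneg z]
  obtain ⟨s, hss⟩ : ∃ s, s = 1 - ‖z‖ ^ 2 := ⟨_, rfl⟩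
  rw [← hss] at hs hS ⊢
  obtain ⟨a, ha⟩ : ∃ a, a = (Real.sqrt s)⁻¹ := ⟨_, rfl⟩
  have ha0 : 0 < a := by rw [ha]; positivity
  have ha2 : a ^ 2 = s⁻¹ := by rw [ha, inv_pow, Real.sq_sqrt hs.le]
  rw [← ha] at hS
  let ℓ : En n →ₗ[ℂ] ℂ := (((a - 1) / ‖z‖ ^ 2 : ℝ) : ℂ) • (innerSL ℂ z).toLinearMap
  let F : En n →ₗ[ℂ] En n := (a : ℂ) • LinearMap.transvection ℓ z
  have hF : ∀ v, F v = (a : ℂ) • (v + (((a - 1) / ‖z‖ ^ 2 : ℝ) : ℂ) • (herm v z) • z) := by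
    intro v
    simp [F, ℓ, LinearMap.transvection, herm_eq, mul_smul]
  have hl : 1 + ℓ z = a := by
    by_cases h0 : z = 0
    · subst h0
      simp at hss
      simp [ha, hss]
    · have hz0 : (‖z‖ : ℂ) ≠ 0 := by simpa using h0
      simp [ℓ]
      field_simp
      ring
  have hdet : LinearMap.det F = (a : ℂ) ^ (n + 1) := by
    rw [LinearMap.det_smul, LinearMap.transvection.det, hl]
    simp [pow_succ]
  have hdetR : LinearMap.det (F.restrictScalars ℝ) = (s ^ (n + 1))⁻¹ := by
    rw [LinearMap.det_restrictScalars, hdet, Algebra.norm_complex_apply, ← Complex.ofReal_pow,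
      Complex.normSq_ofReal, ← inv_pow, ← ha2]
    ring
  have hsub : S ⊆ (fun w => w + (-z)) ⁻¹' ((F.restrictScalars ℝ) ⁻¹' (Metric.ball 0 R)) := by
    intro w hw
    have := hS w hw
    rw [← hF] at this
    simpa [sub_eq_add_neg] using this
  have hne : LinearMap.det (F.restrictScalars ℝ) ≠ 0 := by rw [hdetR]; positivity
  refine (measure_mono hsub).trans ?_
  unfold vol
  rw [measure_preimage_add_right, Measure.addHaar_preimage_linearMap _ hne, hdetR, inv_inv,
    abs_of_pos (by positivity)]

lemma tau_bound {n : ℕ} {γ : ℝ} (hγ : 0 < γ) : ∃ V : ℝ, 0 < V ∧ ∀ z : En n, ‖z‖ < 1 →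
    measTau n (Dball z γ) ≤ ENNReal.ofReal V := by
  obtain ⟨δ, hδ, hD⟩ := D_core (n := n) hγ
  obtain ⟨R, hR⟩ : ∃ R : ℝ, R = Real.sqrt (4 / δ) + (4 / δ + 4) + 1 := ⟨_, rfl⟩
  have hfin : vol n (Metric.ball 0 R) ≠ ⊤ := by unfold vol; exact measure_ball_lt_top.ne
  refine ⟨(δ / 4) ^ (-((n : ℝ) + 1)) * ((vol n (Metric.ball 0 R)).toReal + 1),
    by positivity, fun z hz => ?_⟩
  have hs : 0 < 1 - ‖z‖ ^ 2 := by nlinarith [norm_nonneg z]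
  have hvol : vol n (Dball z γ) ≤
      ENNReal.ofReal ((1 - ‖z‖ ^ 2) ^ (n + 1)) * vol n (Metric.ball 0 R) := by
    apply vol_lin z hz
    intro w hw
    have hw1 : ‖w‖ < 1 := by simpa [uball] using hw.1
    obtain ⟨c1, -, -⟩ := D_est hδ z w hz hw1 (hD z w hz hw)
    have k1 := norm_sub_sq_le w z hw1 hz
    obtain ⟨s, hss⟩ : ∃ s, s = 1 - ‖z‖ ^ 2 := ⟨_, rfl⟩
    rw [← hss] at hs c1 ⊢
    obtain ⟨b, hb⟩ : ∃ b, b = Real.sqrt s := ⟨_, rfl⟩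
    have hb0 : 0 < b := by rw [hb]; positivity
    have hb2 : b ^ 2 = s := by rw [hb, Real.sq_sqrt hs.le]
    rw [← hb]
    have hs1 : s ≤ 1 := by rw [hss]; nlinarith [norm_nonneg z]
    have hb1 : b ≤ 1 := by nlinarith
    have hinv : 1 ≤ b⁻¹ := (one_le_inv₀ hb0).2 hb1
    have hA : ‖1 - herm w z‖ ≤ 2 / δ * s := by
      rw [div_mul_eq_mul_div, le_div_iff₀ hδ]; linarith
    have hX : ‖w - z‖ ≤ Real.sqrt (4 / δ) * b := by
      rw [hb, ← Real.sqrt_mul (by positivity)]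
      apply Real.le_sqrt_of_sq_le
      have : 4 / δ * s = 2 * (2 / δ * s) := by ring
      linarith
    -- projection part
    have hP : ‖(((b⁻¹ - 1) / ‖z‖ ^ 2 : ℝ) : ℂ) • (herm (w - z) z) • z‖ ≤ b⁻¹ * ((4 / δ + 4) * s) := by
      by_cases h0 : z = 0
      · subst h0; simp; positivity
      have hzp : 0 < ‖z‖ := norm_pos_iff.2 h0
      rw [norm_smul, norm_smul, Complex.norm_real, Real.norm_eq_abs,
        abs_of_nonneg (by apply div_nonneg; linarith; positivity)]
      have e : (b⁻¹ - 1) / ‖z‖ ^ 2 * (‖herm (w - z) z‖ * ‖z‖)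
          = (b⁻¹ - 1) * (‖herm (w - z) z‖ / ‖z‖) := by field_simp
      rw [e]
      apply mul_le_mul (by linarith) _ (by positivity) (by positivity)
      rw [div_le_iff₀ hzp]
      have hd : 0 < 4 / δ * s := by positivity
      by_cases hh : 1 / 2 ≤ ‖z‖
      · have e1 : herm (w - z) z = ((s : ℝ) : ℂ) - (1 - herm w z) := by
          have := herm_self z
          simp only [herm_eq] at *
          rw [inner_sub_right, this, hss]; push_cast; ring
        have e2 : ‖herm (w - z) z‖ ≤ s + 2 / δ * s := by
          rw [e1]
          refine (norm_sub_le _ _).trans ?_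
          rw [Complex.norm_real, Real.norm_eq_abs, abs_of_pos hs]; linarith
        have e3 : s + 2 / δ * s ≤ (4 / δ + 4) * s * (1 / 2) := by
          have : (4 / δ + 4) * s * (1 / 2) = 2 / δ * s + 2 * s := by ring
          linarith
        have e4 : (4 / δ + 4) * s * (1 / 2) ≤ (4 / δ + 4) * s * ‖z‖ := by gcongr
        linarith
      · push Not at hh
        have e1 := herm_norm_le (w - z) z
        have e2 := norm_sub_le w z
        refine e1.trans ?_
        gcongr
        nlinarith
    rw [norm_smul, Complex.norm_real, Real.norm_eq_abs, abs_of_pos (by positivity)]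
    have e5 := norm_add_le (w - z) ((((b⁻¹ - 1) / ‖z‖ ^ 2 : ℝ) : ℂ) • (herm (w - z) z) • z)
    calc _ ≤ b⁻¹ * (Real.sqrt (4 / δ) * b + b⁻¹ * ((4 / δ + 4) * s)) := by gcongr; linarith
      _ = Real.sqrt (4 / δ) + (4 / δ + 4) := by rw [← hb2]; field_simp
      _ < R := by rw [hR]; linarith
  obtain ⟨s, hss⟩ : ∃ s, s = 1 - ‖z‖ ^ 2 := ⟨_, rfl⟩
  haveI : SFinite (vol n) := by unfold vol; infer_instance
  have hstep : measTau n (Dball z γ) ≤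
      ENNReal.ofReal ((δ / 4 * s) ^ (-((n : ℝ) + 1))) * vol n (Dball z γ) := by
    unfold measTau
    rw [withDensity_apply']
    calc _ ≤ ∫⁻ w in Dball z γ, ENNReal.ofReal ((δ / 4 * s) ^ (-((n : ℝ) + 1)))
            ∂((vol n).restrict (uball n)) := by
          apply setLIntegral_mono measurable_const
          intro w hw
          have hw1 : ‖w‖ < 1 := by simpa [uball] using hw.1
          obtain ⟨-, -, c3⟩ := D_est hδ z w hz hw1 (hD z w hz hw)
          apply ENNReal.ofReal_le_ofReal
          apply Real.rpow_le_rpow_of_nonpos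
          · rw [hss]; positivity
          · rw [hss]; linarith
          · have : (0 : ℝ) ≤ n := by positivity
            linarith
      _ ≤ _ := by
          rw [setLIntegral_const]
          gcongr
          exact Measure.restrict_le_self
  rw [← hss] at hs hvol
  calc _ ≤ _ := hstep
    _ ≤ ENNReal.ofReal ((δ / 4 * s) ^ (-((n : ℝ) + 1))) *
        (ENNReal.ofReal (s ^ (n + 1)) * ENNReal.ofReal ((vol n (Metric.ball 0 R)).toReal + 1)) := by
        gcongr
        refine hvol.trans ?_
        gcongr
        rw [← ENNReal.ofReal_toReal hfin]
        apply ENNReal.ofReal_le_ofReal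
        rw [ENNReal.ofReal_toReal hfin]
        linarith
    _ = _ := by
        rw [← ENNReal.ofReal_mul (by positivity), ← ENNReal.ofReal_mul (by positivity)]
        congr 1
        rw [Real.mul_rpow (by positivity) hs.le, Real.rpow_neg hs.le]
        have : s ^ ((n : ℝ) + 1) = s ^ (n + 1) := by exact_mod_cast Real.rpow_natCast s (n + 1)
        rw [this]
        field_simp

/-- Size estimate for the tent kernel:
`(∫_{D(z,γ)} |1-⟨w,u⟩|^{-q(n+1+α)} dτ(w))^{1/q} ≤ C / ϱ(z,u)^{n+1+α}`. -/
theorem stmt16 (n : ℕ) (hn : 1 ≤ n) (γ α q : ℝ) (hγ : 0 < γ) (hα : -1 < α) (hq : 1 < q) :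
    ∃ C : ℝ, 0 < C ∧ ∀ z ∈ uball n, ∀ u ∈ uball n, z ≠ u →
      (∫⁻ w in Dball z γ,
          ENNReal.ofReal (‖1 - herm w u‖ ^ (-(q * ((n : ℝ) + 1 + α)))) ∂measTau n) ^ (1 / q) ≤
        ENNReal.ofReal (C / rho z u ^ ((n : ℝ) + 1 + α)) := by
  obtain ⟨δ, hδ, hD⟩ := D_core (n := n) hγ
  obtain ⟨V, hV, htau⟩ := tau_bound (n := n) hγ
  obtain ⟨K, hK⟩ : ∃ K : ℝ, K = 5 * (8 / δ + 4) := ⟨_, rfl⟩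
  have hK0 : 0 < K := by rw [hK]; positivity
  obtain ⟨N, hN⟩ : ∃ N : ℝ, N = (n : ℝ) + 1 + α := ⟨_, rfl⟩
  have hN0 : 0 < N := by
    have : (0 : ℝ) ≤ n := by positivity
    linarith
  rw [← hN]
  have hq0 : 0 < q := by linarith
  refine ⟨K ^ N * V ^ (1 / q), by positivity, fun z hz u hu hzu => ?_⟩
  have hz : ‖z‖ < 1 := by simpa [uball] using hz
  have hu : ‖u‖ < 1 := by simpa [uball] using hu
  have hr := rho_pos z u hzu
  obtain ⟨r, hrr⟩ : ∃ r, r = rho z u := ⟨_, rfl⟩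
  rw [← hrr] at hr ⊢
  have key : ∀ w ∈ Dball z γ, r / K ≤ ‖1 - herm w u‖ := by
    intro w hw
    have hw1 : ‖w‖ < 1 := by simpa [uball] using hw.1
    obtain ⟨-, c2, -⟩ := D_est hδ z w hz hw1 (hD z w hz hw)
    have h1 := quasi_tri z w u hz hw1 hu
    have h2 := rho_le z u hz hu
    have h3 : 1 - ‖w‖ ^ 2 ≤ 2 * ‖1 - herm w u‖ := by
      have := one_sub_herm_ge w u
      nlinarith [norm_nonneg w, norm_nonneg u]
    have h4 : ‖1 - herm z w‖ ≤ 4 / δ * ‖1 - herm w u‖ := by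
      rw [herm_symm_norm, div_mul_eq_mul_div, le_div_iff₀ hδ]; linarith
    rw [div_le_iff₀ hK0, hK, hrr]
    have : ‖1 - herm w u‖ * (5 * (8 / δ + 4)) = 5 * (2 * (4 / δ * ‖1 - herm w u‖) + 4 * ‖1 - herm w u‖) := by ring
    linarith
  have hint : (∫⁻ w in Dball z γ,
      ENNReal.ofReal (‖1 - herm w u‖ ^ (-(q * N))) ∂measTau n) ≤
      ENNReal.ofReal ((r / K) ^ (-(q * N)) * V) := by
    calc _ ≤ ∫⁻ w in Dball z γ, ENNReal.ofReal ((r / K) ^ (-(q * N))) ∂measTau n := by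
          apply setLIntegral_mono measurable_const
          intro w hw
          apply ENNReal.ofReal_le_ofReal
          apply Real.rpow_le_rpow_of_nonpos (by positivity) (key w hw)
          have : 0 < q * N := by positivity
          linarith
      _ ≤ _ := by
          rw [setLIntegral_const, ENNReal.ofReal_mul (by positivity)]
          gcongr
          exact htau z hz
  refine (ENNReal.rpow_le_rpow hint (by positivity)).trans (le_of_eq ?_)
  rw [ENNReal.ofReal_rpow_of_pos (by positivity)]
  congr 1
  rw [Real.mul_rpow (by positivity) hV.le, ← Real.rpow_mul (by positivity)]
  have : -(q * N) * (1 / q) = -N := by field_simp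
  rw [this, Real.rpow_neg (by positivity), Real.div_rpow hr.le hK0.le]
  field_simp
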